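/- arXiv:2108.09791 — 3 statements merged into one kernel-verified Lean document; each statement's English description precedes it below -/
import Mathlib

section
/- Let n ≥ 1. If v₀, v₁, …, vₙ are n+1 nonzero vectors in ℂ² that are pairwise linearly independent (no two of them are proportional), then the vectors Ψₙ(v₀), Ψₙ(v₁), …, Ψₙ(vₙ) are linearly independent in ℂ^{n+1}; in particular they form a basis of ℂ^{n+1}. (Equivalently: every set of n+1 distinct points of the Veronese curve 𝒞ₙ is linearly independent.) -/
open Matrix Filter Topology

/-- The Veronese lift `Ψₙ : ℂ² → ℂ^{n+1}`, whose `k`-th coordinate at `(x, y)` is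
`C(n,k) · x^(n-k) · y^k`. -/
noncomputable def veronese (n : ℕ) (v : Fin 2 → ℂ) : Fin (n + 1) → ℂ :=
  fun k => (n.choose (k : ℕ) : ℂ) * v 0 ^ (n - (k : ℕ)) * v 1 ^ (k : ℕ)

/-- The matrix `ϱₙ(A)`: the n-th symmetric power of the 2×2 matrix `A` written in the
Veronese basis, given by the explicit entry formula. -/
noncomputable def rho (n : ℕ) (A : Matrix (Fin 2) (Fin 2) ℂ) :
    Matrix (Fin (n + 1)) (Fin (n + 1)) ℂ :=
  fun m j =>
    ((n.choose (m : ℕ) : ℂ) / (n.choose (j : ℕ) : ℂ)) *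
      ∑ l ∈ Finset.Icc ((j : ℕ) - (n - (m : ℕ))) (min (j : ℕ) (m : ℕ)),
        (((n - (m : ℕ)).choose ((j : ℕ) - l) : ℂ) * (((m : ℕ).choose l : ℕ) : ℂ)) *
          A 0 0 ^ (n - (m : ℕ) - ((j : ℕ) - l)) * A 0 1 ^ ((j : ℕ) - l) *
          A 1 0 ^ ((m : ℕ) - l) * A 1 1 ^ l

/-- The matrix of Veronese lifts is a homogeneous Vandermonde matrix with its columns scaled by
binomial coefficients. -/
theorem of_veronese_eq_projVandermonde_mul_diagonal (n : ℕ) (v : Fin (n + 1) → (Fin 2 → ℂ)) :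
    Matrix.of (fun i => veronese n (v i)) =
      projVandermonde (fun i => v i 1) (fun i => v i 0) *
        diagonal (fun k : Fin (n + 1) => (n.choose (k : ℕ) : ℂ)) := by
  ext i k
  have hk : (k.rev : ℕ) = n - k := by simp [Fin.val_rev]
  rw [mul_diagonal, projVandermonde_apply, hk, of_apply, veronese]
  ring

theorem det_of_veronese_ne_zero (n : ℕ) (v : Fin (n + 1) → (Fin 2 → ℂ))
    (hvpair : ∀ i j, i ≠ j → LinearIndependent ℂ ![v i, v j]) :
    (Matrix.of (fun i => veronese n (v i))).det ≠ 0 := by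
  rw [of_veronese_eq_projVandermonde_mul_diagonal, det_mul, det_diagonal, det_projVandermonde]
  refine mul_ne_zero (Finset.prod_ne_zero_iff.2 fun i _ => Finset.prod_ne_zero_iff.2 fun j hj => ?_)
    (Finset.prod_ne_zero_iff.2 fun k _ => ?_)
  · have hdet : (Matrix.of ![v i, v j]).det ≠ 0 :=
      ((isUnit_iff_isUnit_det _).1
        (linearIndependent_rows_iff_isUnit.1 (hvpair i j (Finset.mem_Ioi.1 hj).ne))).ne_zero
    rw [det_fin_two] at hdet
    simpa [mul_comm] using hdet
  · exact Nat.cast_ne_zero.2 (Nat.choose_ne_zero (Nat.lt_succ_iff.1 k.2))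

/-- Every family of `n+1` nonzero, pairwise linearly independent vectors of `ℂ²` is sent by
the Veronese lift to a linearly independent family of `ℂ^{n+1}`; in particular the images
form a basis of `ℂ^{n+1}`. -/
theorem veronese_points_linearIndependent (n : ℕ) (hn : 1 ≤ n)
    (v : Fin (n + 1) → (Fin 2 → ℂ)) (hv0 : ∀ i, v i ≠ 0)
    (hvpair : ∀ i j, i ≠ j → LinearIndependent ℂ ![v i, v j]) :
    LinearIndependent ℂ (fun i => veronese n (v i)) ∧
      Submodule.span ℂ (Set.range fun i => veronese n (v i)) = ⊤ := by
  have hli : LinearIndependent ℂ (fun i => veronese n (v i)) :=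
    linearIndependent_rows_of_det_ne_zero (det_of_veronese_ne_zero n v hvpair)
  exact ⟨hli, hli.span_eq_top_of_card_eq_finrank (by simp)⟩
end

section
/- Let n ≥ 1. For every 2×2 complex matrix A and every v ∈ ℂ², the matrix ϱₙ(A) defined by the explicit entry formula satisfies ϱₙ(A)·Ψₙ(v) = Ψₙ(A·v). That is, the matrix whose (m,j) entry is (C(n,m)/C(n,j)) · Σ_{l = max(0, j−(n−m))}^{min(j, m)} C(n−m, j−l)·C(m, l)·a^{n−m−j+l}·b^{j−l}·c^{m−l}·d^{l} realizes the n-th symmetric power action of A on the Veronese lifts. -/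
open Matrix Filter Topology

/-- The expansion of a product of powers of two binary linear forms, with the terms collected by
the degree `j` in the second variable. -/
theorem add_pow_mul_add_pow_eq_sum {R : Type*} [CommSemiring R] (a b c d x y : R) (p m : ℕ) :
    (a * x + b * y) ^ p * (c * x + d * y) ^ m =
      ∑ j ∈ Finset.range (p + m + 1),
        (∑ l ∈ Finset.Icc (j - p) (min j m),
          ((p.choose (j - l) : R) * (m.choose l : R)) * a ^ (p - (j - l)) * b ^ (j - l) *
            c ^ (m - l) * d ^ l) * (x ^ (p + m - j) * y ^ j) := by
  rw [add_comm (a * x), add_comm (c * x), add_pow, add_pow, Finset.sum_mul_sum]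
  simp_rw [Finset.sum_mul]
  rw [← Finset.sum_product', Finset.sum_sigma']
  refine Finset.sum_bij' (fun q _ => ⟨q.1 + q.2, q.2⟩) (fun q _ => (q.1 - q.2, q.2))
    ?_ ?_ ?_ ?_ ?_
  · rintro ⟨i, l⟩ h
    simp only [Finset.mem_product, Finset.mem_range, Finset.mem_sigma, Finset.mem_Icc] at h ⊢
    omega
  · rintro ⟨j, l⟩ h
    simp only [Finset.mem_product, Finset.mem_range, Finset.mem_sigma, Finset.mem_Icc] at h ⊢
    omega
  · rintro ⟨i, l⟩ -
    simp
  · rintro ⟨j, l⟩ h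
    simp only [Finset.mem_range, Finset.mem_sigma, Finset.mem_Icc] at h
    have hlj : j - l + l = j := by omega
    simp [hlj]
  · rintro ⟨i, l⟩ h
    simp only [Finset.mem_product, Finset.mem_range] at h
    have hx : p + m - (i + l) = (p - i) + (m - l) := by omega
    simp only [Nat.add_sub_cancel, hx, mul_pow, pow_add]
    ring

/-- The explicit matrix `ϱₙ(A)` realizes the n-th symmetric power action of `A` on Veronese
lifts: `ϱₙ(A) · Ψₙ(v) = Ψₙ(A·v)` for every 2×2 complex matrix `A` and every `v ∈ ℂ²`. -/
theorem rho_mulVec_veronese (n : ℕ) (hn : 1 ≤ n) (A : Matrix (Fin 2) (Fin 2) ℂ)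
    (v : Fin 2 → ℂ) :
    rho n A *ᵥ veronese n v = veronese n (A *ᵥ v) := by
  ext m
  have hm : n - (m : ℕ) + m = n := Nat.sub_add_cancel (Nat.le_of_lt_succ m.isLt)
  have key := add_pow_mul_add_pow_eq_sum (A 0 0) (A 0 1) (A 1 0) (A 1 1) (v 0) (v 1) (n - m) m
  rw [hm, Finset.sum_range] at key
  simp only [veronese, mulVec, dotProduct, Fin.sum_univ_two]
  rw [mul_assoc, key, Finset.mul_sum]
  refine Finset.sum_congr rfl fun j _ => ?_
  have hj : (n.choose (j : ℕ) : ℂ) ≠ 0 :=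
    Nat.cast_ne_zero.mpr (Nat.choose_pos (Nat.le_of_lt_succ j.isLt)).ne'
  simp only [rho]
  field_simp
end

section
/- Let n ≥ 1 and let Γ be a subgroup of SL(2,ℂ) which is discrete (i.e., Γ carries the discrete topology as a subspace of the 2×2 complex matrices). Then the image subgroup ϱₙ(Γ) = { ϱₙ(A) : A ∈ Γ } of SL(n+1,ℂ) is discrete (it carries the discrete topology as a subspace of the (n+1)×(n+1) complex matrices). -/
open Matrix Filter Topology

/-- The four corner entries of `ϱₙ(A)` are the `n`-th powers of the entries of `A`. -/
theorem exists_rho_eq_pow (n : ℕ) (A : Matrix (Fin 2) (Fin 2) ℂ) (i j : Fin 2) :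
    ∃ m k : Fin (n + 1), rho n A m k = A i j ^ n := by
  fin_cases i <;> fin_cases j
  · exact ⟨0, 0, by simp [rho]⟩
  · exact ⟨0, Fin.last n, by simp [rho]⟩
  · exact ⟨Fin.last n, 0, by simp [rho]⟩
  · exact ⟨Fin.last n, Fin.last n, by simp [rho]⟩

/-- A bound on the entries of `ϱₙ(A)` is inherited by the entries of `A`. -/
theorem norm_apply_le_of_norm_rho_le {n : ℕ} (hn : 1 ≤ n) {A : Matrix (Fin 2) (Fin 2) ℂ} {R : ℝ}
    (hR : 1 ≤ R) (h : ∀ m k, ‖rho n A m k‖ ≤ R) (i j : Fin 2) : ‖A i j‖ ≤ R := by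
  obtain ⟨m, k, hmk⟩ := exists_rho_eq_pow n A i j
  have hpow : ‖A i j‖ ^ n ≤ R ^ n := by
    rw [← norm_pow, ← hmk]
    exact (h m k).trans (le_self_pow₀ hR (by lia))
  exact (pow_le_pow_iff_left₀ (norm_nonneg _) (by linarith) (by lia)).1 hpow

/-- The matrices of a discrete subgroup of `SL(2,ℂ)` form a closed set of matrices. -/
theorem isClosed_coe_image_of_discrete (Γ : Subgroup (Matrix.SpecialLinearGroup (Fin 2) ℂ))
    (hΓ : DiscreteTopology
      ((fun g : Matrix.SpecialLinearGroup (Fin 2) ℂ => (g : Matrix (Fin 2) (Fin 2) ℂ)) ''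
        (Γ : Set (Matrix.SpecialLinearGroup (Fin 2) ℂ)) : Set (Matrix (Fin 2) (Fin 2) ℂ))) :
    IsClosed ((fun g : Matrix.SpecialLinearGroup (Fin 2) ℂ => (g : Matrix (Fin 2) (Fin 2) ℂ)) ''
        (Γ : Set (Matrix.SpecialLinearGroup (Fin 2) ℂ))) := by
  have hemb : IsClosedEmbedding
      (fun g : Matrix.SpecialLinearGroup (Fin 2) ℂ => (g : Matrix (Fin 2) (Fin 2) ℂ)) :=
    (isClosed_eq (continuous_id.matrix_det) continuous_const).isClosedEmbedding_subtypeVal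
  have : DiscreteTopology Γ := by
    let e := hemb.isEmbedding.homeomorphImage (Γ : Set (Matrix.SpecialLinearGroup (Fin 2) ℂ))
    exact e.symm.discreteTopology
  exact hemb.isClosedMap _ Γ.isClosed_of_discrete

/-- A discrete subgroup of `SL(2,ℂ)` has only finitely many elements with entries bounded by a
given constant. -/
theorem finite_setOf_norm_apply_le_of_discrete
    (Γ : Subgroup (Matrix.SpecialLinearGroup (Fin 2) ℂ))
    (hΓ : DiscreteTopology
      ((fun g : Matrix.SpecialLinearGroup (Fin 2) ℂ => (g : Matrix (Fin 2) (Fin 2) ℂ)) ''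
        (Γ : Set (Matrix.SpecialLinearGroup (Fin 2) ℂ)) : Set (Matrix (Fin 2) (Fin 2) ℂ)))
    (R : ℝ) :
    {g : Matrix.SpecialLinearGroup (Fin 2) ℂ | g ∈ Γ ∧ ∀ i j, ‖g i j‖ ≤ R}.Finite := by
  have hK : IsCompact {A : Matrix (Fin 2) (Fin 2) ℂ | ∀ i j, ‖A i j‖ ≤ R} := by
    have hEq : {A : Matrix (Fin 2) (Fin 2) ℂ | ∀ i j, ‖A i j‖ ≤ R} =
        Set.univ.pi fun _ => Set.univ.pi fun _ => Metric.closedBall (0 : ℂ) R := by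
      ext A
      refine Iff.trans ?_ (Set.mem_univ_pi (f := A)).symm
      exact forall_congr' fun i => by simp [-Fin.forall_fin_two]
    rw [hEq]
    exact isCompact_univ_pi fun _ => isCompact_univ_pi fun _ => isCompact_closedBall _ _
  have hfin := (hK.inter_left (isClosed_coe_image_of_discrete Γ hΓ)).finite
    (IsDiscrete.mono ⟨hΓ⟩ Set.inter_subset_left)
  refine Set.Finite.of_finite_image (hfin.subset ?_) Subtype.val_injective.injOn
  rintro _ ⟨g, ⟨hg, hgR⟩, rfl⟩
  exact ⟨⟨g, hg, rfl⟩, hgR⟩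

/-- If `Γ` is a discrete subgroup of `SL(2,ℂ)` (its set of underlying matrices carries the
discrete topology as a subspace of the 2×2 complex matrices), then the image subgroup
`ϱₙ(Γ)` of `SL(n+1,ℂ)` is discrete as a subspace of the `(n+1)×(n+1)` complex matrices. -/
theorem rho_image_discrete (n : ℕ) (hn : 1 ≤ n)
    (Γ : Subgroup (Matrix.SpecialLinearGroup (Fin 2) ℂ))
    (hΓ : DiscreteTopology
      ((fun g : Matrix.SpecialLinearGroup (Fin 2) ℂ => (g : Matrix (Fin 2) (Fin 2) ℂ)) ''
        (Γ : Set (Matrix.SpecialLinearGroup (Fin 2) ℂ)) : Set (Matrix (Fin 2) (Fin 2) ℂ))) :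
    DiscreteTopology
      ((fun g : Matrix.SpecialLinearGroup (Fin 2) ℂ => rho n (g : Matrix (Fin 2) (Fin 2) ℂ)) ''
        (Γ : Set (Matrix.SpecialLinearGroup (Fin 2) ℂ)) :
          Set (Matrix (Fin (n + 1)) (Fin (n + 1)) ℂ)) := by
  rw [discreteTopology_iff_isOpen_singleton]
  rintro ⟨x, hx⟩
  set R : ℝ := 1 + ∑ m, ∑ k, ‖x m k‖
  have hxR : ∀ m k, ‖x m k‖ < R := fun m k => by
    have h₁ : ‖x m k‖ ≤ ∑ k, ‖x m k‖ :=
      Finset.single_le_sum (f := fun k => ‖x m k‖) (fun _ _ => norm_nonneg _) (Finset.mem_univ k)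
    have h₂ : ∑ k, ‖x m k‖ ≤ ∑ m, ∑ k, ‖x m k‖ :=
      Finset.single_le_sum (f := fun m => ∑ k, ‖x m k‖)
        (fun _ _ => Finset.sum_nonneg fun _ _ => norm_nonneg _) (Finset.mem_univ m)
    linarith
  have hR1 : 1 ≤ R :=
    le_add_of_nonneg_right (Finset.sum_nonneg fun _ _ => Finset.sum_nonneg fun _ _ => norm_nonneg _)
  have hU : IsOpen {B : Matrix (Fin (n + 1)) (Fin (n + 1)) ℂ | ∀ m k, ‖B m k‖ < R} := by
    simp only [Set.ofPred_forall]
    exact isOpen_iInter_of_finite fun m => isOpen_iInter_of_finite fun k =>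
      isOpen_lt (continuous_id.matrix_elem m k).norm continuous_const
  refine isOpen_singleton_of_finite_mem_nhds _
    ((hU.preimage continuous_subtype_val).mem_nhds hxR) ?_
  refine Set.Finite.of_finite_image (f := Subtype.val) ?_ Subtype.val_injective.injOn
  refine ((finite_setOf_norm_apply_le_of_discrete Γ hΓ R).image
    fun g : Matrix.SpecialLinearGroup (Fin 2) ℂ => rho n (g : Matrix (Fin 2) (Fin 2) ℂ)).subset ?_
  rintro _ ⟨⟨_, g, hg, rfl⟩, hgR, rfl⟩
  exact ⟨g, ⟨hg, norm_apply_le_of_norm_rho_le hn hR1 fun m k => (hgR m k).le⟩, rfl⟩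
end
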